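/- If the information transfer from every state z_i to the output θ of the system z(t+1) = A z(t), θ(t) = C z(t) + ω(t) is non-zero, then in the extended directed graph every state node has a directed path to the output node, and hence the system is structurally observable. -/

import Mathlib

open Matrix

/-- The output trajectory of the system `z(t+1) = A z(t)`,
`θ(t) = C z(t) + ω(t)`. -/
noncomputable def outTraj {ι : Type*} [Fintype ι] [DecidableEq ι] (A : Matrix ι ι ℝ)
    (C : ι → ℝ) (z0 : ι → ℝ) (ω : ℕ → ℝ) (k : ℕ) : ℝ :=
  C ⬝ᵥ ((A ^ k) *ᵥ z0) + ω k

/-- The edge relation of the extended graph with an output node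
(`Sum.inl ()` is the output `θ`): `z_i → z_j` iff `A j i ≠ 0`,
`z_i → θ` iff `C i ≠ 0`, no edges out of `θ`. -/
def extOutEdge {N : ℕ} (A : Matrix (Fin N) (Fin N) ℝ) (C : Fin N → ℝ) :
    Unit ⊕ Fin N → Unit ⊕ Fin N → Prop :=
  fun p q =>
    match p, q with
    | Sum.inr i', Sum.inr j' => A j' i' ≠ 0
    | Sum.inr i', Sum.inl _ => C i' ≠ 0
    | Sum.inl _, _ => False

lemma vecMul_pow_supp {N : ℕ} (A : Matrix (Fin N) (Fin N) ℝ) (C : Fin N → ℝ) (k : ℕ) :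
    ∀ j, (C ᵥ* A ^ k) j ≠ 0 → Relation.TransGen (extOutEdge A C) (Sum.inr j) (Sum.inl ()) := by
  induction k with
  | zero =>
    intro j hj
    simp only [pow_zero, Matrix.vecMul_one] at hj
    exact Relation.TransGen.single hj
  | succ k ih =>
    intro j hj
    rw [pow_succ, ← Matrix.vecMul_vecMul] at hj
    change ∑ m, (C ᵥ* A ^ k) m * A m j ≠ 0 at hj
    obtain ⟨m, -, hm⟩ := Finset.exists_ne_zero_of_sum_ne_zero hj
    have h1 := left_ne_zero_of_mul hm
    have h2 : A m j ≠ 0 := right_ne_zero_of_mul hm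
    exact Relation.TransGen.head (b := Sum.inr m) h2 (ih m h1)

lemma vecMul_pow_submatrix {N : ℕ} (A : Matrix (Fin N) (Fin N) ℝ) (C : Fin N → ℝ) (i : Fin N)
    (h : ∀ k, (C ᵥ* A ^ k) i = 0) (k : ℕ) :
    ∀ m : {l : Fin N // l ≠ i}, ((fun l : {l : Fin N // l ≠ i} => C l) ᵥ*
      (A.submatrix (Subtype.val : {l : Fin N // l ≠ i} → Fin N) Subtype.val) ^ k) m
      = (C ᵥ* A ^ k) m := by
  induction k with
  | zero => intro m; simp
  | succ k ih =>
    intro m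
    rw [pow_succ, pow_succ, ← Matrix.vecMul_vecMul, ← Matrix.vecMul_vecMul]
    change ∑ j : {l : Fin N // l ≠ i}, _ * _ = ∑ j, (C ᵥ* A ^ k) j * A j m
    rw [Fintype.sum_eq_add_sum_subtype_ne _ i, h k, zero_mul, zero_add]
    exact Finset.sum_congr rfl fun j _ => by rw [ih j]; rfl

/-- If the information transfer from every state `z_i` to the output `θ` of
the system `z(t+1) = A z(t)`, `θ(t) = C z(t) + ω(t)` is non-zero (for some
number of steps), then in the extended directed graph every state node has a
directed path to the output node; hence the system is structurally observable
(output reachability).  The `k`-step transfer from `z_i` to `θ` is expressed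
via an (arbitrary) entropy functional `Hent k` of the random output
trajectory, where freezing `z_i` means evolving by the principal submatrix of
`A` (and the restriction of `C`) deleting node `i`. -/
theorem structurally_observable_of_transfer_ne_zero {N : ℕ}
    (A : Matrix (Fin N) (Fin N) ℝ) (C : Fin N → ℝ)
    (Hent : (k : ℕ) →
      (((Fin N → ℝ) → (ℕ → ℝ) → Fin (k + 1) → ℝ)) → ℝ)
    (htransfer : ∀ i : Fin N, ∃ k : ℕ, 1 ≤ k ∧
      Hent k (fun z0 ω l => outTraj A C z0 ω l)
        - Hent k (fun z0 ω l =>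
            outTraj (A.submatrix (Subtype.val : {l : Fin N // l ≠ i} → Fin N) Subtype.val)
              (fun l => C l) (fun l => z0 l) ω l) ≠ 0) :
    ∀ i : Fin N, Relation.TransGen (extOutEdge A C) (Sum.inr i) (Sum.inl ()) := by
  intro i
  by_contra hn
  have h : ∀ k, (C ᵥ* A ^ k) i = 0 := fun k => by
    by_contra hk
    exact hn (vecMul_pow_supp A C k i hk)
  obtain ⟨k, -, hk⟩ := htransfer i
  apply hk
  rw [sub_eq_zero]
  congr 1
  funext z0 ω l
  unfold outTraj
  rw [Matrix.dotProduct_mulVec, Matrix.dotProduct_mulVec]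
  congr 1
  change ∑ j, (C ᵥ* A ^ (l : ℕ)) j * z0 j = ∑ j : {l : Fin N // l ≠ i}, _ * _
  rw [Fintype.sum_eq_add_sum_subtype_ne _ i, h, zero_mul, zero_add]
  exact Finset.sum_congr rfl fun j _ => by rw [vecMul_pow_submatrix A C i h]
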